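/- Fix q ∈ [1,2], δ > 0, σ_w > 0, and a random variable B with E[B²] < ∞ independent of Z ~ N(0,1). Define χ_min = inf{ χ ≥ 0 : (1/δ)·E[η_q(Z;χ)²] ≤ 1 }. Then for every fixed χ ∈ (χ_min, ∞), the equation σ² = σ_w² + (1/δ)·E[(η_q(B + σZ; χσ^{2−q}) − B)²] has a unique solution σ ∈ (0,∞); and for every χ ∈ (0, χ_min), this equation has no solution σ ∈ (0,∞). -/

import Mathlib

open MeasureTheory ProbabilityTheory Real Filter Set

noncomputable section

/-- The standard Gaussian measure on `ℝ`. -/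
def stdGaussian : Measure ℝ := gaussianReal 0 1

/-- `IsProx q χ u v` : `v` minimizes `z ↦ (1/2)(u−z)² + χ|z|^q`,
i.e. `v = η_q(u;χ)` is the proximal operator of `χ|·|^q` at `u`. -/
def IsProx (q χ u v : ℝ) : Prop :=
  ∀ z : ℝ, (1/2) * (u - v)^2 + χ * |v| ^ q ≤ (1/2) * (u - z)^2 + χ * |z| ^ q

/-- The stationarity map `v ↦ v + χ q v^(q-1)` whose inverse is the proximal operator on `[0,∞)`. -/
def proxInverse (q χ v : ℝ) : ℝ := v + χ * (q * v ^ (q - 1))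

section Prox

variable {q χ : ℝ}

lemma proxInverse_sub_monotone (hq1 : 1 ≤ q) (hχ : 0 ≤ χ) {v w : ℝ} (hv : 0 ≤ v) (h : v ≤ w) :
    w - v ≤ proxInverse q χ w - proxInverse q χ v := by
  have h1 : v ^ (q - 1) ≤ w ^ (q - 1) := Real.rpow_le_rpow hv h (by linarith)
  have h2 : χ * (q * v ^ (q - 1)) ≤ χ * (q * w ^ (q - 1)) := by gcongr
  unfold proxInverse
  linarith

lemma proxInverse_lt (hq1 : 1 ≤ q) (hχ : 0 ≤ χ) {v w : ℝ} (hv : 0 ≤ v) (h : v < w) :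
    proxInverse q χ v < proxInverse q χ w := by
  linarith [proxInverse_sub_monotone hq1 hχ hv h.le]

lemma proxInverse_le_of_le (hq1 : 1 ≤ q) {c d v : ℝ} (h : c ≤ d) (hv : 0 ≤ v) :
    proxInverse q c v ≤ proxInverse q d v := by
  have : 0 ≤ v ^ (q - 1) := Real.rpow_nonneg hv _
  unfold proxInverse
  gcongr

lemma proxInverse_lt_of_lt (hq1 : 1 ≤ q) {c d v : ℝ} (h : c < d) (hv : 0 < v) :
    proxInverse q c v < proxInverse q d v := by
  have : 0 < v ^ (q - 1) := Real.rpow_pos_of_pos hv _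
  unfold proxInverse
  gcongr

lemma concaveOn_proxInverse (hq1 : 1 ≤ q) (hq2 : q ≤ 2) (hχ : 0 ≤ χ) :
    ConcaveOn ℝ (Ici 0) (proxInverse q χ) := by
  have h1 : ConcaveOn ℝ (Ici 0) (fun v : ℝ => v ^ (q - 1)) :=
    Real.concaveOn_rpow (by linarith) (by linarith)
  have h2 := (h1.smul (by linarith : 0 ≤ q)).smul hχ
  exact (concaveOn_id (convex_Ici 0)).add h2

lemma IsProx.neg {u v : ℝ} (h : IsProx q χ u v) : IsProx q χ (-u) (-v) := by
  intro z
  have := h (-z)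
  rw [abs_neg] at this ⊢
  convert this using 2 <;> ring

lemma IsProx.zero (hq1 : 1 ≤ q) (hχ : 0 ≤ χ) {v : ℝ} (h : IsProx q χ 0 v) : v = 0 := by
  have h0 := h 0
  rw [abs_zero, Real.zero_rpow (by linarith)] at h0
  have : 0 ≤ χ * |v| ^ q := by positivity
  nlinarith

lemma IsProx.nonneg (hq1 : 1 ≤ q) (hχ : 0 ≤ χ) {u v : ℝ} (hu : 0 ≤ u) (h : IsProx q χ u v) :
    0 ≤ v := by
  rcases hu.eq_or_lt with rfl | hu
  · exact (h.zero hq1 hχ).ge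
  · have := h (-v)
    rw [abs_neg] at this
    nlinarith

lemma IsProx.eq_proxInverse {u v : ℝ} (hv : 0 < v) (h : IsProx q χ u v) :
    u = proxInverse q χ v := by
  have hd : HasDerivAt (fun z : ℝ => (1/2) * (u - z)^2 + χ * z ^ q)
      ((1/2) * (2 * (u - v) * (-1)) + χ * (q * v ^ (q - 1))) v := by
    have h1 : HasDerivAt (fun z : ℝ => u - z) (-1) v := by
      simpa using (hasDerivAt_id v).const_sub u
    have h2 := (h1.pow 2).const_mul (1/2)
    have h3 := (Real.hasDerivAt_rpow_const (p := q) (Or.inl hv.ne')).const_mul χ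
    exact (h2.add h3).congr_deriv (by norm_num)
  have hmin : IsLocalMin (fun z : ℝ => (1/2) * (u - z)^2 + χ * z ^ q) v := by
    filter_upwards [lt_mem_nhds hv] with z hz
    have := h z
    rwa [abs_of_pos hz, abs_of_pos hv] at this
  have := hmin.hasDerivAt_eq_zero hd
  unfold proxInverse
  linarith

lemma IsProx.le_proxInverse (hq1 : 1 ≤ q) (hχ : 0 ≤ χ) {u v : ℝ} (hu : 0 ≤ u)
    (h : IsProx q χ u v) : u ≤ proxInverse q χ v := by
  rcases (h.nonneg hq1 hχ hu).eq_or_lt with rfl | hv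
  · have hbound : ∀ z : ℝ, 0 < z → u ≤ z / 2 + χ * z ^ (q - 1) := by
      intro z hz
      have h1 := h z
      rw [abs_zero, Real.zero_rpow (by linarith), abs_of_pos hz] at h1
      have h2 : z ^ q = z * z ^ (q - 1) := by
        rw [← Real.rpow_one_add' hz.le (by linarith)]
        congr 1
        ring
      rw [h2] at h1
      refine le_of_mul_le_mul_left ?_ hz
      nlinarith
    have hc : Continuous (fun z : ℝ => z / 2 + χ * z ^ (q - 1)) := by
      have := Real.continuous_rpow_const (q := q - 1) (by linarith)
      fun_prop
    have hlim : Tendsto (fun z : ℝ => z / 2 + χ * z ^ (q - 1)) (nhdsWithin 0 (Ioi 0))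
        (nhds (0 / 2 + χ * 0 ^ (q - 1))) := (hc.tendsto 0).mono_left nhdsWithin_le_nhds
    have hle := ge_of_tendsto hlim (eventually_mem_nhdsWithin.mono fun z hz => hbound z hz)
    have h0 : (0 : ℝ) ≤ 0 ^ (q - 1) := Real.rpow_nonneg le_rfl _
    have : χ * 0 ^ (q - 1) ≤ χ * (q * 0 ^ (q - 1)) := by
      gcongr
      nlinarith
    unfold proxInverse
    linarith
  · exact (h.eq_proxInverse hv).le

/-- The proximal operator is nonincreasing in the penalty level. -/
lemma IsProx.le_of_le (hq1 : 1 ≤ q) {c d u v w : ℝ} (hc : 0 ≤ c) (hcd : c ≤ d) (hu : 0 ≤ u)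
    (hv : IsProx q c u v) (hw : IsProx q d u w) : w ≤ v := by
  by_contra! hlt
  have hv0 := hv.nonneg hq1 hc hu
  have h1 := hv.le_proxInverse hq1 hc hu
  have h2 := hw.eq_proxInverse (hv0.trans_lt hlt)
  linarith [proxInverse_lt hq1 hc hv0 hlt, proxInverse_le_of_le hq1 hcd (hv0.trans hlt.le)]

lemma IsProx.lt_of_lt (hq1 : 1 ≤ q) {c d u v w : ℝ} (hc : 0 ≤ c) (hcd : c < d)
    (hv0 : 0 < v) (hv : IsProx q c u v) (hw : IsProx q d u w) : w < v := by
  by_contra! hlt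
  have h1 := hv.eq_proxInverse hv0
  have h2 := hw.eq_proxInverse (hv0.trans_le hlt)
  linarith [proxInverse_sub_monotone hq1 hc hv0.le hlt,
    proxInverse_lt_of_lt hq1 hcd (hv0.trans_le hlt)]

lemma IsProx.unique (hq1 : 1 ≤ q) (hχ : 0 ≤ χ) {u v w : ℝ}
    (hv : IsProx q χ u v) (hw : IsProx q χ u w) : v = w := by
  rcases le_total 0 u with hu | hu
  · exact le_antisymm (hw.le_of_le hq1 hχ le_rfl hu hv) (hv.le_of_le hq1 hχ le_rfl hu hw)
  · have hu' : 0 ≤ -u := by linarith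
    exact neg_injective (le_antisymm (hw.neg.le_of_le hq1 hχ le_rfl hu' hv.neg)
      (hv.neg.le_of_le hq1 hχ le_rfl hu' hw.neg))

/-- The proximal operator is nondecreasing on `[0,∞)`. -/
lemma IsProx.mono (hq1 : 1 ≤ q) (hχ : 0 ≤ χ) {u u' v v' : ℝ} (hu : 0 ≤ u) (huu : u ≤ u')
    (hv : IsProx q χ u v) (hv' : IsProx q χ u' v') : v ≤ v' := by
  by_contra! hlt
  have hv0 := hv'.nonneg hq1 hχ (hu.trans huu)
  have h1 := hv'.le_proxInverse hq1 hχ (hu.trans huu)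
  have h2 := hv.eq_proxInverse (hv0.trans_lt hlt)
  linarith [proxInverse_lt hq1 hχ hv0 hlt]

/-- The proximal operator is nonexpansive on `[0,∞)`. -/
lemma IsProx.sub_le_sub (hq1 : 1 ≤ q) (hχ : 0 ≤ χ) {u u' v v' : ℝ} (hu : 0 ≤ u) (huu : u ≤ u')
    (hv : IsProx q χ u v) (hv' : IsProx q χ u' v') : v' - v ≤ u' - u := by
  rcases le_or_gt v' v with hle | hlt
  · linarith
  · have hv0 := hv.nonneg hq1 hχ hu
    have h1 := hv.le_proxInverse hq1 hχ hu
    have h2 := hv'.eq_proxInverse (hv0.trans_lt hlt)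
    linarith [proxInverse_sub_monotone hq1 hχ hv0 hlt.le]

/-- The proximal operator is convex on `[0,∞)`. -/
lemma IsProx.le_convexCombination (hq1 : 1 ≤ q) (hq2 : q ≤ 2) (hχ : 0 ≤ χ)
    {u u' v v' w a b : ℝ} (hu : 0 ≤ u) (hu' : 0 ≤ u') (ha : 0 ≤ a) (hb : 0 ≤ b) (hab : a + b = 1)
    (hv : IsProx q χ u v) (hv' : IsProx q χ u' v') (hw : IsProx q χ (a * u + b * u') w) :
    w ≤ a * v + b * v' := by
  by_contra! hlt
  have hv0 := hv.nonneg hq1 hχ hu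
  have hv0' := hv'.nonneg hq1 hχ hu'
  have h0 : 0 ≤ a * v + b * v' := by positivity
  have h1 := hw.eq_proxInverse (h0.trans_lt hlt)
  have h2 := (concaveOn_proxInverse hq1 hq2 hχ).2 hv0 hv0' ha hb hab
  simp only [smul_eq_mul] at h2
  have h3 := mul_le_mul_of_nonneg_left (hv.le_proxInverse hq1 hχ hu) ha
  have h4 := mul_le_mul_of_nonneg_left (hv'.le_proxInverse hq1 hχ hu') hb
  linarith [proxInverse_lt hq1 hχ h0 hlt]

/-- The proximal operator is positively homogeneous when the penalty level is rescaled. -/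
lemma IsProx.scale {u v s : ℝ} (hs : 0 < s) (h : IsProx q χ u v) :
    IsProx q (χ * s ^ (2 - q)) (s * u) (s * v) := by
  have key : ∀ y : ℝ, (1/2) * (s * u - s * y)^2 + χ * s ^ (2 - q) * |s * y| ^ q
      = s ^ 2 * ((1/2) * (u - y)^2 + χ * |y| ^ q) := by
    intro y
    have h1 : s ^ (2 - q) * s ^ q = s ^ 2 := by
      rw [← Real.rpow_add hs, ← Real.rpow_natCast]
      congr 1
      push_cast
      ring
    rw [abs_mul, abs_of_pos hs, Real.mul_rpow hs.le (abs_nonneg y)]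
    linear_combination χ * |y| ^ q * h1
  intro z
  have hz : z = s * (z / s) := by field_simp
  rw [hz, key, key]
  exact mul_le_mul_of_nonneg_left (h _) (by positivity)

lemma IsProx.sq_le_div (hq1 : 1 ≤ q) (hq2 : q ≤ 2) (hχ : 0 < χ) {u v : ℝ} (hu : 0 ≤ u)
    (h : IsProx q χ u v) : v ^ 2 ≤ (u ^ 2 + u ^ 4) / χ := by
  have hv0 := h.nonneg hq1 hχ.le hu
  rcases hv0.eq_or_lt with rfl | hv
  · rw [zero_pow two_ne_zero]
    positivity
  have h1 := h.eq_proxInverse hv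
  have hpow : 0 ≤ v ^ (q - 1) := by positivity
  unfold proxInverse at h1
  have hvu : v ≤ u := by
    have : 0 ≤ χ * (q * v ^ (q - 1)) := by positivity
    linarith
  have h2 : χ * v ^ (q - 1) ≤ u := by
    have : χ * (1 * v ^ (q - 1)) ≤ χ * (q * v ^ (q - 1)) := by gcongr
    linarith
  have h3 : v ^ 2 = v ^ (q - 1) * v ^ (3 - q) := by
    rw [← Real.rpow_add hv, ← Real.rpow_natCast]
    congr 1
    push_cast
    ring
  have h4 : v ^ (3 - q) ≤ u * (1 + u ^ 2) := by
    have e : v ^ (3 - q) = v * v ^ (2 - q) := by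
      rw [← Real.rpow_one_add' hv.le (by linarith)]
      congr 1
      ring
    rw [e]
    have : v ^ (2 - q) ≤ 1 + u ^ 2 := by
      rcases le_total v 1 with h | h
      · have := Real.rpow_le_one hv.le h (by linarith : 0 ≤ 2 - q)
        nlinarith
      · have := Real.rpow_le_rpow_of_exponent_le h (by linarith : 2 - q ≤ 1)
        rw [Real.rpow_one] at this
        nlinarith
    gcongr
  rw [le_div_iff₀ hχ, h3]
  calc v ^ (q - 1) * v ^ (3 - q) * χ = χ * v ^ (q - 1) * v ^ (3 - q) := by ring
    _ ≤ u * (u * (1 + u ^ 2)) := by gcongr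
    _ = u ^ 2 + u ^ 4 := by ring

end Prox

section Gaussian

instance : IsProbabilityMeasure stdGaussian := by
  unfold _root_.stdGaussian
  infer_instance

lemma integrable_pow_stdGaussian (n : ℕ) : Integrable (fun z : ℝ => z ^ n) stdGaussian := by
  rcases Nat.eq_zero_or_pos n with rfl | hn
  · simp
  have h : MemLp (id : ℝ → ℝ) (n : NNReal) stdGaussian := memLp_id_gaussianReal n
  have := h.integrable_norm_pow (p := n) hn.ne'
  refine (integrable_norm_iff (by fun_prop)).1 ?_
  simpa using this

lemma integral_comp_neg_stdGaussian (f : ℝ → ℝ) :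
    ∫ z, f (-z) ∂stdGaussian = ∫ z, f z ∂stdGaussian := by
  have hmp : MeasurePreserving (fun x : ℝ => -x) stdGaussian stdGaussian :=
    ⟨measurable_neg, by simp [_root_.stdGaussian, gaussianReal_map_neg]⟩
  exact hmp.integral_comp (Homeomorph.neg ℝ).measurableEmbedding f

lemma integral_stdGaussian (f : ℝ → ℝ) :
    ∫ z, f z ∂stdGaussian = ∫ z, gaussianPDFReal 0 1 z * f z := by
  simpa [_root_.stdGaussian] using
    integral_gaussianReal_eq_integral_smul (μ := 0) (v := 1) (f := f) one_ne_zero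

lemma MeasureTheory.Integrable.gaussianPDFReal_mul {f : ℝ → ℝ} (hf : Integrable f stdGaussian) :
    Integrable (fun z => gaussianPDFReal 0 1 z * f z) := by
  unfold _root_.stdGaussian at hf
  rw [gaussianReal_of_var_ne_zero 0 one_ne_zero,
    integrable_withDensity_iff_integrable_smul' (measurable_gaussianPDF 0 1)
      (Eventually.of_forall fun x => gaussianPDF_lt_top)] at hf
  simpa [toReal_gaussianPDF] using hf

lemma gaussianPDFReal_le_of_abs_le {a b : ℝ} (h : |a| ≤ |b|) :
    gaussianPDFReal 0 1 b ≤ gaussianPDFReal 0 1 a := by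
  have := sq_le_sq.2 h
  simp only [gaussianPDFReal_def, sub_zero]
  gcongr

/-- One-dimensional Anderson inequality: the Gaussian mean of a function that is nondecreasing
in the absolute value is nondecreasing in the shift. -/
lemma integral_comp_add_stdGaussian_mono {f : ℝ → ℝ} (hf : ∀ u v, |u| ≤ |v| → f u ≤ f v)
    (hint : ∀ x, Integrable (fun z => f (x + z)) stdGaussian) {x y : ℝ} (hx : 0 ≤ x)
    (hxy : x ≤ y) :
    ∫ z, f (x + z) ∂stdGaussian ≤ ∫ z, f (y + z) ∂stdGaussian := by
  obtain ⟨m, d, hd, hm, rfl, rfl⟩ : ∃ m d : ℝ, 0 ≤ d ∧ 0 ≤ m ∧ x = m - d ∧ y = m + d :=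
    ⟨(x + y) / 2, (y - x) / 2, by linarith, by linarith, by ring, by ring⟩
  set φ := gaussianPDFReal 0 1 with hφ
  have hφeven : ∀ s, φ (-s) = φ s := fun s =>
    le_antisymm (gaussianPDFReal_le_of_abs_le (by simp)) (gaussianPDFReal_le_of_abs_le (by simp))
  have e1 : ∫ z, f (m - d + z) ∂stdGaussian = ∫ s, φ (s + d) * f (m + s) := by
    rw [integral_stdGaussian, ← integral_add_right_eq_self _ d]
    congr 1 with s
    congr 2
    ring
  have e2 : ∫ z, f (m + d + z) ∂stdGaussian = ∫ s, φ (s - d) * f (m + s) := by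
    rw [integral_stdGaussian, ← integral_sub_right_eq_self _ d]
    congr 1 with s
    congr 2
    ring
  have i1 : Integrable (fun s => φ (s + d) * f (m + s)) := by
    refine ((hint (m - d)).gaussianPDFReal_mul.comp_add_right d).congr
      (Eventually.of_forall fun s => ?_)
    simp only [hφ]
    congr 2
    ring
  have i2 : Integrable (fun s => φ (s - d) * f (m + s)) := by
    refine ((hint (m + d)).gaussianPDFReal_mul.comp_sub_right d).congr
      (Eventually.of_forall fun s => ?_)
    simp only [hφ]
    congr 2
    ring
  rw [e1, e2, ← sub_nonneg, ← integral_sub i2 i1]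
  set D : ℝ → ℝ := fun s => φ (s - d) * f (m + s) - φ (s + d) * f (m + s) with hD
  have iD : Integrable D := i2.sub i1
  have hsymm : 0 ≤ ∫ s, (D s + D (-s)) := by
    refine integral_nonneg fun s => ?_
    have r1 : φ (-s - d) = φ (s + d) := by rw [← hφeven]; congr 1; ring
    have r2 : φ (-s + d) = φ (s - d) := by rw [← hφeven]; congr 1; ring
    have e : D s + D (-s) = (φ (s - d) - φ (s + d)) * (f (m + s) - f (m + -s)) := by
      simp only [hD, r1, r2]
      ring
    simp only [Pi.zero_apply, e]
    rcases le_total 0 s with hs | hs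
    · refine mul_nonneg (sub_nonneg.2 (gaussianPDFReal_le_of_abs_le ?_)) (sub_nonneg.2 (hf _ _ ?_))
      · exact sq_le_sq.1 (by nlinarith)
      · exact sq_le_sq.1 (by nlinarith)
    · refine mul_nonneg_of_nonpos_of_nonpos
        (sub_nonpos.2 (gaussianPDFReal_le_of_abs_le ?_)) (sub_nonpos.2 (hf _ _ ?_))
      · exact sq_le_sq.1 (by nlinarith)
      · exact sq_le_sq.1 (by nlinarith)
  rw [integral_add iD iD.comp_neg, integral_neg_eq_self] at hsymm
  linarith

end Gaussian

/-- Odd, nondecreasing, nonexpansive functions that are concave on `[0,∞)`; the residual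
`u ↦ u - η_q(u;χ)` of the proximal operator is one. -/
structure IsOddConcaveContraction (g : ℝ → ℝ) : Prop where
  odd : ∀ x, g (-x) = -g x
  mono : Monotone g
  lip : LipschitzWith 1 g
  concave : ConcaveOn ℝ (Ici 0) g

lemma ConcaveOn.add_le_add_of_mem_Icc {s : Set ℝ} {f : ℝ → ℝ} (hf : ConcaveOn ℝ s f)
    {a b c d : ℝ} (ha : a ∈ s) (hd : d ∈ s) (hab : a ≤ b) (hbd : b ≤ d) (h : a + d = b + c) :
    f a + f d ≤ f b + f c := by
  rcases (hab.trans hbd).eq_or_lt with rfl | had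
  · obtain rfl : b = a := le_antisymm hbd hab
    obtain rfl : c = b := by linarith
    rfl
  have hpos : 0 < d - a := by linarith
  have h1 : 0 ≤ (d - b) / (d - a) := div_nonneg (by linarith) hpos.le
  have h2 : 0 ≤ (b - a) / (d - a) := div_nonneg (by linarith) hpos.le
  have h3 : (d - b) / (d - a) + (b - a) / (d - a) = 1 := by field_simp; ring
  have k1 := hf.2 ha hd h1 h2 h3
  have k2 := hf.2 ha hd h2 h1 (by linarith)
  have eb : (d - b) / (d - a) * a + (b - a) / (d - a) * d = b := by field_simp; ring
  have ec : (b - a) / (d - a) * a + (d - b) / (d - a) * d = c := by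
    obtain rfl : c = a + d - b := by linarith
    field_simp
    ring
  simp only [smul_eq_mul, eb, ec] at k1 k2
  have : f a + f d = ((d - b) / (d - a) * f a + (b - a) / (d - a) * f d)
      + ((b - a) / (d - a) * f a + (d - b) / (d - a) * f d) := by
    linear_combination -(f a + f d) * h3
  linarith

/-- Mean squared error, at signal `x` in standard Gaussian noise, of the denoiser with
residual `g`. -/
def gaussianRisk (g : ℝ → ℝ) (x : ℝ) : ℝ := ∫ z, (z - g (x + z)) ^ 2 ∂stdGaussian

namespace IsOddConcaveContraction

variable {g : ℝ → ℝ}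

lemma map_zero (hg : IsOddConcaveContraction g) : g 0 = 0 := by
  have := hg.odd 0
  rw [neg_zero] at this
  linarith

lemma abs_le (hg : IsOddConcaveContraction g) (u : ℝ) : |g u| ≤ |u| := by
  simpa [Real.dist_eq, hg.map_zero] using hg.lip.dist_le_mul u 0

lemma abs_le_abs (hg : IsOddConcaveContraction g) {u v : ℝ} (h : |u| ≤ |v|) :
    |g u| ≤ |g v| := by
  have key : ∀ w, |g w| = g |w| := by
    intro w
    rcases le_total 0 w with hw | hw
    · rw [abs_of_nonneg hw, abs_of_nonneg (hg.map_zero ▸ hg.mono hw)]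
    · rw [abs_of_nonpos hw, hg.odd, abs_of_nonpos (hg.map_zero ▸ hg.mono hw)]
  rw [key, key]
  exact hg.mono h

/-- Concavity makes the symmetric increment around `x ≥ 0` nonincreasing in `x`. -/
lemma symmDiff_antitone (hg : IsOddConcaveContraction g) {x y z : ℝ} (hx : 0 ≤ x) (hxy : x ≤ y)
    (hz : 0 ≤ z) : g (y + z) - g (y - z) ≤ g (x + z) - g (x - z) := by
  have far : ∀ x y, z ≤ x → x ≤ y → g (y + z) - g (y - z) ≤ g (x + z) - g (x - z) := by
    intro x y hzx hxy
    have := hg.concave.add_le_add_of_mem_Icc (a := x - z) (b := x + z) (c := y - z) (d := y + z)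
      (mem_Ici.2 (by linarith)) (mem_Ici.2 (by linarith)) (by linarith) (by linarith) (by ring)
    linarith
  have near : ∀ x y, 0 ≤ x → x ≤ y → y ≤ z →
      g (y + z) - g (y - z) ≤ g (x + z) - g (x - z) := by
    intro x y hx hxy hyz
    have := hg.concave.add_le_add_of_mem_Icc (a := z - y) (b := x + z) (c := z - x) (d := y + z)
      (mem_Ici.2 (by linarith)) (mem_Ici.2 (by linarith)) (by linarith) (by linarith) (by ring)
    rw [← neg_sub z y, ← neg_sub z x, hg.odd, hg.odd]
    linarith
  rcases le_total z x with h | h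
  · exact far x y h hxy
  rcases le_total y z with h' | h'
  · exact near x y hx hxy h'
  · exact (far z y le_rfl h').trans (near x z hx h le_rfl)

lemma sq_sub_le (hg : IsOddConcaveContraction g) (x z : ℝ) :
    (z - g (x + z)) ^ 2 ≤ 6 * z ^ 2 + 4 * x ^ 2 := by
  have := sq_le_sq.2 (hg.abs_le (x + z))
  nlinarith [sq_nonneg (z + g (x + z)), sq_nonneg (x - z)]

lemma integrable_sq (hg : IsOddConcaveContraction g) (x : ℝ) :
    Integrable (fun z => g (x + z) ^ 2) stdGaussian := by
  have hc := hg.lip.continuous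
  refine (((integrable_pow_stdGaussian 2).const_mul 2).add (integrable_const (2 * x ^ 2))).mono'
    (Continuous.aestronglyMeasurable (by fun_prop)) (Eventually.of_forall fun z => ?_)
  rw [Real.norm_eq_abs, abs_of_nonneg (sq_nonneg _)]
  have := sq_le_sq.2 (hg.abs_le (x + z))
  simp only [Pi.add_apply]
  nlinarith [sq_nonneg (x - z)]

lemma integrable_mul (hg : IsOddConcaveContraction g) (x : ℝ) :
    Integrable (fun z => z * g (x + z)) stdGaussian := by
  have hc := hg.lip.continuous
  refine ((integrable_pow_stdGaussian 2).add (hg.integrable_sq x)).mono'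
    (Continuous.aestronglyMeasurable (by fun_prop)) (Eventually.of_forall fun z => ?_)
  rw [Real.norm_eq_abs, abs_mul]
  simp only [Pi.add_apply]
  nlinarith [sq_nonneg (|z| - |g (x + z)|), sq_abs z, sq_abs (g (x + z))]

lemma gaussianRisk_eq (hg : IsOddConcaveContraction g) (x : ℝ) :
    gaussianRisk g x = ∫ z, z ^ 2 ∂stdGaussian - 2 * ∫ z, z * g (x + z) ∂stdGaussian
      + ∫ z, g (x + z) ^ 2 ∂stdGaussian := by
  have h2 := integrable_pow_stdGaussian 2
  have hm := (hg.integrable_mul x).const_mul 2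
  have hd : Integrable (fun z => z ^ 2 - 2 * (z * g (x + z))) stdGaussian := h2.sub hm
  rw [← integral_const_mul, ← integral_sub h2 hm, ← integral_add hd (hg.integrable_sq x)]
  unfold gaussianRisk
  congr 1 with z
  ring

lemma integral_mul_eq (hg : IsOddConcaveContraction g) (x : ℝ) :
    2 * ∫ z, z * g (x + z) ∂stdGaussian
      = ∫ z, z * (g (x + z) - g (x - z)) ∂stdGaussian := by
  have h := integral_comp_neg_stdGaussian (fun z => z * g (x + z))
  have hi : Integrable (fun z => -z * g (x + -z)) stdGaussian := by
    have hc := hg.lip.continuous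
    refine ((integrable_pow_stdGaussian 2).add
      (((integrable_pow_stdGaussian 2).const_mul 2).add
      (integrable_const (2 * x ^ 2)))).mono' (Continuous.aestronglyMeasurable (by fun_prop)) (Eventually.of_forall fun z => ?_)
    rw [Real.norm_eq_abs, abs_mul, abs_neg]
    have := sq_le_sq.2 (hg.abs_le (x + -z))
    simp only [Pi.add_apply]
    nlinarith [sq_nonneg (|z| - |g (x + -z)|), sq_abs z, sq_abs (g (x + -z)), sq_nonneg (x + z)]
  rw [two_mul]
  nth_rewrite 2 [← h]
  rw [← integral_add (hg.integrable_mul x) hi]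
  congr 1 with z
  rw [← sub_eq_add_neg]
  ring

lemma integrable_mul_sub (hg : IsOddConcaveContraction g) (x : ℝ) :
    Integrable (fun z => z * (g (x + z) - g (x - z))) stdGaussian := by
  have hc := hg.lip.continuous
  refine ((integrable_pow_stdGaussian 2).const_mul 2).mono' (Continuous.aestronglyMeasurable (by fun_prop))
    (Eventually.of_forall fun z => ?_)
  have h := hg.lip.dist_le_mul (x + z) (x - z)
  rw [Real.dist_eq, Real.dist_eq, NNReal.coe_one, one_mul,
    show x + z - (x - z) = 2 * z by ring, abs_mul, abs_two] at h
  rw [Real.norm_eq_abs, abs_mul, ← sq_abs z]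
  nlinarith [abs_nonneg z]

lemma gaussianRisk_mono (hg : IsOddConcaveContraction g) {x y : ℝ} (hx : 0 ≤ x) (hxy : x ≤ y) :
    gaussianRisk g x ≤ gaussianRisk g y := by
  have h1 : ∫ z, z * (g (y + z) - g (y - z)) ∂stdGaussian
      ≤ ∫ z, z * (g (x + z) - g (x - z)) ∂stdGaussian := by
    refine integral_mono (hg.integrable_mul_sub y) (hg.integrable_mul_sub x) fun z => ?_
    rcases le_total 0 z with hz | hz
    · exact mul_le_mul_of_nonneg_left (hg.symmDiff_antitone hx hxy hz) hz
    · have := hg.symmDiff_antitone hx hxy (neg_nonneg.2 hz)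
      simp only [sub_neg_eq_add, ← sub_eq_add_neg] at this
      exact mul_le_mul_of_nonpos_left (by linarith) hz
  have h2 := integral_comp_add_stdGaussian_mono (f := fun u => g u ^ 2)
    (fun u v h => sq_le_sq.2 (hg.abs_le_abs h)) hg.integrable_sq hx hxy
  rw [hg.gaussianRisk_eq, hg.gaussianRisk_eq, hg.integral_mul_eq, hg.integral_mul_eq]
  linarith

lemma gaussianRisk_neg (hg : IsOddConcaveContraction g) (x : ℝ) :
    gaussianRisk g (-x) = gaussianRisk g x := by
  unfold gaussianRisk
  rw [← integral_comp_neg_stdGaussian]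
  congr 1 with z
  rw [← neg_add, hg.odd]
  ring

lemma gaussianRisk_le_of_abs_le (hg : IsOddConcaveContraction g) {x y : ℝ} (h : |x| ≤ |y|) :
    gaussianRisk g x ≤ gaussianRisk g y := by
  have key : ∀ w, gaussianRisk g w = gaussianRisk g |w| := by
    intro w
    rcases abs_choice w with e | e <;> rw [e]
    rw [hg.gaussianRisk_neg]
  rw [key x, key y]
  exact hg.gaussianRisk_mono (abs_nonneg x) h

lemma gaussianRisk_nonneg (x : ℝ) : 0 ≤ gaussianRisk g x :=
  integral_nonneg fun _ => sq_nonneg _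

lemma gaussianRisk_le (hg : IsOddConcaveContraction g) (x : ℝ) :
    gaussianRisk g x ≤ 6 * ∫ z, z ^ 2 ∂stdGaussian + 4 * x ^ 2 := by
  have hi := (integrable_pow_stdGaussian 2).const_mul 6
  have e : 6 * ∫ z, z ^ 2 ∂stdGaussian + 4 * x ^ 2
      = ∫ z, (6 * z ^ 2 + 4 * x ^ 2) ∂stdGaussian := by
    rw [integral_add hi (integrable_const _), integral_const_mul]
    simp
  rw [e]
  exact integral_mono_of_nonneg (Eventually.of_forall fun _ => sq_nonneg _)
    (hi.add (integrable_const _)) (Eventually.of_forall fun z => hg.sq_sub_le x z)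

lemma continuous_gaussianRisk (hg : IsOddConcaveContraction g) : Continuous (gaussianRisk g) := by
  refine continuous_iff_continuousAt.2 fun x₀ => ?_
  refine continuousAt_of_dominated (bound := fun z => 6 * z ^ 2 + 4 * (|x₀| + 1) ^ 2)
    (Eventually.of_forall fun x => ?_) ?_ ?_ (Eventually.of_forall fun z => ?_)
  · have hc := hg.lip.continuous
    exact Continuous.aestronglyMeasurable (by fun_prop)
  · filter_upwards [Metric.ball_mem_nhds x₀ one_pos] with x hx
    refine Eventually.of_forall fun z => ?_
    rw [Real.norm_eq_abs, abs_of_nonneg (sq_nonneg _)]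
    refine (hg.sq_sub_le x z).trans ?_
    have h1 : |x| ≤ |x₀| + 1 := by
      rw [Metric.mem_ball, Real.dist_eq] at hx
      linarith [abs_sub_abs_le_abs_sub x x₀]
    rw [← sq_abs x]
    gcongr
  · exact ((integrable_pow_stdGaussian 2).const_mul 6).add (integrable_const _)
  · have := hg.lip.continuous
    fun_prop

variable {μ : Measure ℝ} [IsProbabilityMeasure μ]

lemma integrable_gaussianRisk (hg : IsOddConcaveContraction g)
    (hμ : Integrable (fun b => b ^ 2) μ) (t : ℝ) :
    Integrable (fun b => gaussianRisk g (t * b)) μ := by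
  have hc := hg.continuous_gaussianRisk
  refine ((integrable_const (6 * ∫ z, z ^ 2 ∂stdGaussian)).add
    (hμ.const_mul (4 * t ^ 2))).mono' (Continuous.aestronglyMeasurable (by fun_prop)) (Eventually.of_forall fun b => ?_)
  rw [Real.norm_eq_abs, abs_of_nonneg (gaussianRisk_nonneg _)]
  refine (hg.gaussianRisk_le (t * b)).trans (le_of_eq ?_)
  simp only [Pi.add_apply]
  ring

lemma continuous_integral_gaussianRisk (hg : IsOddConcaveContraction g)
    (hμ : Integrable (fun b => b ^ 2) μ) :
    Continuous fun t => ∫ b, gaussianRisk g (t * b) ∂μ := by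
  have hc := hg.continuous_gaussianRisk
  refine continuous_iff_continuousAt.2 fun t₀ => ?_
  refine continuousAt_of_dominated (bound := fun b => gaussianRisk g ((|t₀| + 1) * b))
    (Eventually.of_forall fun t => by fun_prop) ?_ (hg.integrable_gaussianRisk hμ _)
    (Eventually.of_forall fun b => by fun_prop)
  filter_upwards [Metric.ball_mem_nhds t₀ one_pos] with t ht
  refine Eventually.of_forall fun b => ?_
  rw [Real.norm_eq_abs, abs_of_nonneg (gaussianRisk_nonneg _)]
  refine hg.gaussianRisk_le_of_abs_le ?_
  rw [Metric.mem_ball, Real.dist_eq] at ht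
  rw [abs_mul, abs_mul, abs_of_nonneg (by positivity : 0 ≤ |t₀| + 1)]
  gcongr
  linarith [abs_sub_abs_le_abs_sub t t₀]

lemma integral_gaussianRisk_mono (hg : IsOddConcaveContraction g)
    (hμ : Integrable (fun b => b ^ 2) μ) {s t : ℝ} (hs : 0 ≤ s) (hst : s ≤ t) :
    ∫ b, gaussianRisk g (s * b) ∂μ ≤ ∫ b, gaussianRisk g (t * b) ∂μ := by
  refine integral_mono (hg.integrable_gaussianRisk hμ s) (hg.integrable_gaussianRisk hμ t)
    fun b => hg.gaussianRisk_le_of_abs_le ?_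
  rw [abs_mul, abs_mul, abs_of_nonneg hs, abs_of_nonneg (hs.trans hst)]
  gcongr

end IsOddConcaveContraction

section Residual

variable {q χ : ℝ} {f : ℝ → ℝ}

lemma isOddConcaveContraction_residual (hq1 : 1 ≤ q) (hq2 : q ≤ 2) (hχ : 0 ≤ χ)
    (hf : ∀ u, IsProx q χ u (f u)) : IsOddConcaveContraction fun u => u - f u := by
  have fodd : ∀ x, f (-x) = -f x := fun x => (hf (-x)).unique hq1 hχ (hf x).neg
  have godd : ∀ x, -x - f (-x) = -(x - f x) := fun x => by rw [fodd]; ring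
  have fmono : Monotone f := monotone_of_odd_of_monotoneOn_nonneg fodd
    fun u hu v _ huv => (hf u).mono hq1 hχ hu huv (hf v)
  have gmono : Monotone fun u => u - f u := monotone_of_odd_of_monotoneOn_nonneg godd
    fun u hu v _ huv => by
      have := (hf u).sub_le_sub hq1 hχ hu huv (hf v)
      linarith
  refine ⟨godd, gmono, LipschitzWith.of_dist_le_mul fun x y => ?_, convex_Ici 0, ?_⟩
  · rw [NNReal.coe_one, one_mul, Real.dist_eq, Real.dist_eq]
    rcases le_total x y with h | h
    · have h1 := fmono h
      have h2 := gmono h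
      simp only at h2
      rw [abs_of_nonpos (by linarith), abs_of_nonpos (by linarith)]
      linarith
    · have h1 := fmono h
      have h2 := gmono h
      simp only at h2
      rw [abs_of_nonneg (by linarith), abs_of_nonneg (by linarith)]
      linarith
  · intro u hu v hv a b ha hb hab
    have := (hf u).le_convexCombination hq1 hq2 hχ hu hv ha hb hab (hf v) (hf (a * u + b * v))
    simp only [smul_eq_mul]
    linarith

lemma gaussianRisk_residual (f : ℝ → ℝ) (x : ℝ) :
    gaussianRisk (fun u => u - f u) x = ∫ z, (f (x + z) - x) ^ 2 ∂stdGaussian := by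
  unfold gaussianRisk
  congr 1 with z
  ring

lemma integrable_sq_of_isProx (hq1 : 1 ≤ q) (hq2 : q ≤ 2) (hχ : 0 ≤ χ)
    (hf : ∀ u, IsProx q χ u (f u)) : Integrable (fun z => f z ^ 2) stdGaussian := by
  have hg := isOddConcaveContraction_residual hq1 hq2 hχ hf
  have hc : Continuous f := by
    have e : f = fun u => u - (u - f u) := by
      ext u
      ring
    rw [e]
    exact continuous_id.sub hg.lip.continuous
  refine ((integrable_pow_stdGaussian 2).const_mul 6).mono'
    (hc.pow 2).aestronglyMeasurable (Eventually.of_forall fun z => ?_)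
  rw [Real.norm_eq_abs, abs_of_nonneg (sq_nonneg _)]
  simpa using hg.sq_sub_le 0 z

end Residual

/-- Rescaling by `σ` turns the risk at noise level `σ` into the risk at noise level one. -/
lemma integral_risk_eq {q χ σ : ℝ} (hq1 : 1 ≤ q) (hχ : 0 ≤ χ) (hσ : 0 < σ) {η : ℝ → ℝ → ℝ}
    (hη : ∀ u χ, 0 ≤ χ → IsProx q χ u (η u χ)) (μ : Measure ℝ) :
    ∫ b, (∫ z, (η (b + σ * z) (χ * σ ^ (2 - q)) - b)^2 ∂stdGaussian) ∂μ
      = σ ^ 2 * ∫ b, gaussianRisk (fun u => u - η u χ) (σ⁻¹ * b) ∂μ := by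
  rw [← integral_const_mul]
  congr 1 with b
  rw [gaussianRisk_residual (fun u => η u χ), ← integral_const_mul]
  congr 1 with z
  have hχ' : 0 ≤ χ * σ ^ (2 - q) := by positivity
  have e : b + σ * z = σ * (σ⁻¹ * b + z) := by field_simp
  have h : η (b + σ * z) (χ * σ ^ (2 - q)) = σ * η (σ⁻¹ * b + z) χ := by
    rw [e]
    exact (hη _ _ hχ').unique hq1 hχ' ((hη _ _ hχ).scale hσ)
  rw [h]
  field_simp

section SecondMoment

variable {q : ℝ} {η : ℝ → ℝ → ℝ}

lemma exists_integral_sq_le (hq1 : 1 ≤ q) (hq2 : q ≤ 2)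
    (hη : ∀ u χ, 0 ≤ χ → IsProx q χ u (η u χ)) {δ : ℝ} (hδ : 0 < δ) :
    ∃ c : ℝ, 0 ≤ c ∧ ∫ z, (η z c)^2 ∂stdGaussian ≤ δ := by
  have hi : Integrable (fun z : ℝ => z ^ 2 + z ^ 4) stdGaussian :=
    (integrable_pow_stdGaussian 2).add (integrable_pow_stdGaussian 4)
  set K := ∫ z : ℝ, (z ^ 2 + z ^ 4) ∂stdGaussian with hK
  have hK0 : 0 ≤ K := integral_nonneg fun z => by positivity
  have hc : 0 < (K + 1) / δ := by positivity
  refine ⟨(K + 1) / δ, hc.le, ?_⟩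
  have hb : ∀ z, (η z ((K + 1) / δ)) ^ 2 ≤ (z ^ 2 + z ^ 4) / ((K + 1) / δ) := by
    intro z
    have h := hη z _ hc.le
    rcases le_total 0 z with hz | hz
    · exact h.sq_le_div hq1 hq2 hc hz
    · have := h.neg.sq_le_div hq1 hq2 hc (neg_nonneg.2 hz)
      simpa [even_two.neg_pow, (by decide : Even 4).neg_pow] using this
  calc ∫ z, (η z ((K + 1) / δ)) ^ 2 ∂stdGaussian
      ≤ ∫ z, (z ^ 2 + z ^ 4) / ((K + 1) / δ) ∂stdGaussian :=
        integral_mono (integrable_sq_of_isProx hq1 hq2 hc.le fun u => hη u _ hc.le)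
          (hi.div_const _) hb
    _ = K / ((K + 1) / δ) := by rw [integral_div]
    _ ≤ δ := by
      rw [div_div_eq_mul_div, div_le_iff₀ (by linarith)]
      nlinarith

/-- The second moment of the proximal operator decreases strictly below `δ` once the penalty
level exceeds one at which it is at most `δ`. -/
lemma integral_sq_lt (hq1 : 1 ≤ q) (hq2 : q ≤ 2)
    (hη : ∀ u χ, 0 ≤ χ → IsProx q χ u (η u χ)) {δ c χ : ℝ} (hδ : 0 < δ) (hc : 0 ≤ c)
    (hcχ : c < χ) (h : ∫ z, (η z c)^2 ∂stdGaussian ≤ δ) :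
    ∫ z, (η z χ)^2 ∂stdGaussian < δ := by
  have hχ : 0 ≤ χ := hc.trans hcχ.le
  have key : ∀ u v w : ℝ, 0 ≤ u → IsProx q c u v → IsProx q χ u w →
      w ^ 2 ≤ v ^ 2 ∧ (w ^ 2 = v ^ 2 → v = 0) := by
    intro u v w hu hv hw
    have hw0 := hw.nonneg hq1 hχ hu
    have hle := hv.le_of_le hq1 hc hcχ.le hu hw
    refine ⟨by gcongr, fun heq => ?_⟩
    rcases (hv.nonneg hq1 hc hu).eq_or_lt with h0 | h0
    · exact h0.symm
    · have := hv.lt_of_lt hq1 hc hcχ h0 hw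
      nlinarith
  have key' : ∀ z, η z χ ^ 2 ≤ η z c ^ 2 ∧ (η z χ ^ 2 = η z c ^ 2 → η z c = 0) := by
    intro z
    rcases le_total 0 z with hz | hz
    · exact key z _ _ hz (hη z c hc) (hη z χ hχ)
    · simpa using key (-z) _ _ (neg_nonneg.2 hz) (hη z c hc).neg (hη z χ hχ).neg
  have i1 := integrable_sq_of_isProx hq1 hq2 hχ fun u => hη u χ hχ
  have i2 := integrable_sq_of_isProx hq1 hq2 hc fun u => hη u c hc
  have hle : ∫ z, η z χ ^ 2 ∂stdGaussian ≤ ∫ z, η z c ^ 2 ∂stdGaussian :=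
    integral_mono i1 i2 fun z => (key' z).1
  rcases (hle.trans h).lt_or_eq with hlt | heq
  · exact hlt
  · have hae := (integral_eq_iff_of_ae_le i1 i2 (Eventually.of_forall fun z => (key' z).1)).1
      (le_antisymm hle (h.trans heq.ge))
    have h0 : ∫ z, η z χ ^ 2 ∂stdGaussian = 0 := by
      refine integral_eq_zero_of_ae ?_
      filter_upwards [hae] with z hz
      rw [hz, (key' z).2 hz]
      simp
    linarith

end SecondMoment

/-- With `χ_min = inf{χ ≥ 0 : (1/δ)E[η_q(Z;χ)²] ≤ 1}`, the equation
`σ² = σ_w² + (1/δ)E[(η_q(B+σZ;χσ^{2−q}) − B)²]` has a unique positive solution for every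
`χ > χ_min`, and no positive solution for `χ ∈ (0, χ_min)`. -/
theorem fixed_point_equation_solvability
    (q δ σw : ℝ) (hq1 : 1 ≤ q) (hq2 : q ≤ 2) (hδ : 0 < δ) (hσw : 0 < σw)
    (μB : Measure ℝ) [IsProbabilityMeasure μB]
    (hB : Integrable (fun b => b^2) μB)
    (η : ℝ → ℝ → ℝ) (hη : ∀ u χ, 0 ≤ χ → IsProx q χ u (η u χ)) :
    (∀ χ : ℝ,
      sInf {c : ℝ | 0 ≤ c ∧ (1/δ) * ∫ z, (η z c)^2 ∂stdGaussian ≤ 1} < χ →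
      ∃! σ : ℝ, 0 < σ ∧
        σ ^ 2 = σw ^ 2 + (1/δ) *
          ∫ b, (∫ z, (η (b + σ * z) (χ * σ ^ (2 - q)) - b)^2 ∂stdGaussian) ∂μB) ∧
    (∀ χ : ℝ, 0 < χ →
      χ < sInf {c : ℝ | 0 ≤ c ∧ (1/δ) * ∫ z, (η z c)^2 ∂stdGaussian ≤ 1} →
      ¬ ∃ σ : ℝ, 0 < σ ∧
        σ ^ 2 = σw ^ 2 + (1/δ) *
          ∫ b, (∫ z, (η (b + σ * z) (χ * σ ^ (2 - q)) - b)^2 ∂stdGaussian) ∂μB) := by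
  set S : Set ℝ := {c : ℝ | 0 ≤ c ∧ (1/δ) * ∫ z, (η z c)^2 ∂stdGaussian ≤ 1} with hS
  have hmem : ∀ c, c ∈ S ↔ 0 ≤ c ∧ ∫ z, (η z c)^2 ∂stdGaussian ≤ δ := by
    intro c
    rw [hS, mem_ofPred_eq, one_div, inv_mul_le_iff₀ hδ, mul_one]
  have hbdd : BddBelow S := ⟨0, fun c hc => hc.1⟩
  have hne : S.Nonempty := by
    obtain ⟨c, hc⟩ := exists_integral_sq_le hq1 hq2 hη hδ
    exact ⟨c, (hmem c).2 hc⟩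
  let G : ℝ → ℝ → ℝ := fun χ t =>
    σw ^ 2 * t ^ 2 + (1/δ) * ∫ b, gaussianRisk (fun u => u - η u χ) (t * b) ∂μB
  have hiff : ∀ χ, 0 ≤ χ → ∀ σ, 0 < σ → (σ ^ 2 = σw ^ 2 + (1/δ) *
      ∫ b, (∫ z, (η (b + σ * z) (χ * σ ^ (2 - q)) - b)^2 ∂stdGaussian) ∂μB ↔
      G χ σ⁻¹ = 1) := by
    intro χ hχ σ hσ
    have e : σw ^ 2 + (1/δ) * (σ ^ 2 * ∫ b, gaussianRisk (fun u => u - η u χ) (σ⁻¹ * b) ∂μB)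
        = σ ^ 2 * G χ σ⁻¹ := by
      simp only [G]
      field_simp
    rw [integral_risk_eq hq1 hχ hσ hη, e, eq_comm, mul_eq_left₀ (by positivity)]
  have hG0 : ∀ χ, G χ 0 = (1/δ) * ∫ z, (η z χ)^2 ∂stdGaussian := by
    intro χ
    simp [G, gaussianRisk_residual (fun u => η u χ)]
  have hg : ∀ χ, 0 ≤ χ → IsOddConcaveContraction fun u => u - η u χ := fun χ hχ =>
    isOddConcaveContraction_residual hq1 hq2 hχ fun u => hη u χ hχ
  have hGmono : ∀ χ, 0 ≤ χ → StrictMonoOn (G χ) (Ici 0) := by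
    intro χ hχ s hs t _ hst
    have h1 := (hg χ hχ).integral_gaussianRisk_mono hB hs hst.le
    have h2 : s ^ 2 < t ^ 2 := pow_lt_pow_left₀ hst hs two_ne_zero
    refine add_lt_add_of_lt_of_le ?_ ?_ <;> gcongr
  refine ⟨fun χ hlt => ?_, fun χ hχ hlt => ?_⟩
  · obtain ⟨c, hcS, hcχ⟩ := exists_lt_of_csInf_lt hne hlt
    obtain ⟨hc, hcδ⟩ := (hmem c).1 hcS
    have hχ : 0 ≤ χ := hc.trans hcχ.le
    have hlt0 : G χ 0 < 1 := by
      rw [hG0, one_div, inv_mul_lt_iff₀ hδ, mul_one]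
      exact integral_sq_lt hq1 hq2 hη hδ hc hcχ hcδ
    have hge : 1 ≤ G χ σw⁻¹ := by
      have h0 : 0 ≤ ∫ b, gaussianRisk (fun u => u - η u χ) (σw⁻¹ * b) ∂μB :=
        integral_nonneg fun b => IsOddConcaveContraction.gaussianRisk_nonneg _
      have h1 : σw ^ 2 * σw⁻¹ ^ 2 = 1 := by field_simp
      simp only [G, h1]
      have : 0 ≤ (1/δ) * ∫ b, gaussianRisk (fun u => u - η u χ) (σw⁻¹ * b) ∂μB := by positivity
      linarith
    have hcont : Continuous (G χ) := by
      have := (hg χ hχ).continuous_integral_gaussianRisk hB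
      fun_prop
    obtain ⟨t, ht, htG⟩ := intermediate_value_Icc (inv_nonneg.2 hσw.le) hcont.continuousOn
      ⟨hlt0.le, hge⟩
    have ht0 : 0 < t := ht.1.lt_of_ne (by rintro rfl; exact hlt0.ne htG)
    refine ⟨t⁻¹, ⟨inv_pos.2 ht0, (hiff χ hχ _ (inv_pos.2 ht0)).2 (by rwa [inv_inv])⟩, ?_⟩
    rintro σ ⟨hσ, heq⟩
    have hσG := (hiff χ hχ σ hσ).1 heq
    have := (hGmono χ hχ).injOn (mem_Ici.2 (inv_nonneg.2 hσ.le)) ht.1 (hσG.trans htG.symm)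
    rw [← this, inv_inv]
  · rintro ⟨σ, hσ, heq⟩
    have hσG := (hiff χ hχ.le σ hσ).1 heq
    have hlt0 := hGmono χ hχ.le (mem_Ici.2 le_rfl) (mem_Ici.2 (inv_nonneg.2 hσ.le)) (inv_pos.2 hσ)
    rw [hσG, hG0] at hlt0
    exact (csInf_le hbdd (show χ ∈ S from ⟨hχ.le, hlt0.le⟩)).not_gt hlt
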